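/- Let P ⊆ I_n^m with #P = d, set d' = #π_{m−1}(P) and n' = n − Σ_{j ≠ m−1} #π_j(P). Then P ∈ APS_d(m,n) if and only if all of the following hold: (1) d ≤ ⌊(n−1)/2⌋; (2) the norm sets |π_i(P)|, for 0 ≤ i ≤ m−1, are pairwise disjoint; (3) the image of the norm set |π_{m−1}(P)| under the unique order-preserving bijection from {1,…,n} ∖ ⋃_{j ≠ m−1}|π_j(P)| onto {1,…,n'} is an admissible pinnacle set of cardinality d' for the symmetric group S_{n'} = Z_1 ≀ S_{n'} (identifying I_{n'}^1 with {1,…,n'}). -/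

import Mathlib

open Finset

/-- `Prec p q` means the colored symbol `p = ξ^{p.1}(p.2)` precedes (is smaller than)
`q = ξ^{q.1}(q.2)`: `a > b`, or (`a = b` and `x > y`). -/
def Prec (p q : ℕ × ℕ) : Prop :=
  q.1 < p.1 ∨ (p.1 = q.1 ∧ q.2 < p.2)

instance : DecidableRel Prec := fun p q => by
  unfold Prec; infer_instance

/-- `w : ℕ → ℕ × ℕ` (read on positions `1,…,n`) is an element of `Z_m ≀ S_n`:
each entry has color `< m` and norm in `{1,…,n}`, and the norms are pairwise distinct. -/
def IsGenPerm (m n : ℕ) (w : ℕ → ℕ × ℕ) : Prop :=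
  (∀ i ∈ Finset.Icc 1 n, (w i).1 < m ∧ (w i).2 ∈ Finset.Icc 1 n) ∧
    Set.InjOn (fun i => (w i).2) (Set.Icc 1 n)

/-- The pinnacle set of the word `w`: values at interior positions `2 ≤ i ≤ n-1`
that strictly dominate both neighbors. -/
def pin (n : ℕ) (w : ℕ → ℕ × ℕ) : Finset (ℕ × ℕ) :=
  ((Finset.Icc 2 (n - 1)).filter
      (fun i => Prec (w (i - 1)) (w i) ∧ Prec (w (i + 1)) (w i))).image w

/-- `P` is an admissible pinnacle set for `Z_m ≀ S_n`. -/
def IsAdmissible (m n : ℕ) (P : Finset (ℕ × ℕ)) : Prop :=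
  ∃ w, IsGenPerm m n w ∧ pin n w = P

/-- `APS m n d` : admissible pinnacle sets for `Z_m ≀ S_n` of cardinality at most `d`. -/
def APS (m n d : ℕ) : Set (Finset (ℕ × ℕ)) :=
  {P | IsAdmissible m n P ∧ P.card ≤ d}

/-- The unique order-preserving bijection from a finite set `D ⊆ ℕ` onto
`{1, …, #D}`, evaluated at `x`: the number of elements of `D` that are `≤ x`. -/
def rankIn (D : Finset ℕ) (x : ℕ) : ℕ :=
  (D.filter (· ≤ x)).card

namespace Prec

lemma asymm {p q : ℕ × ℕ} (h : Prec p q) : ¬ Prec q p := by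
  unfold Prec at *; omega

lemma trans {p q r : ℕ × ℕ} (h : Prec p q) (h' : Prec q r) : Prec p r := by
  unfold Prec at *; omega

lemma of_not {p q : ℕ × ℕ} (h : ¬ Prec p q) (hne : p ≠ q) : Prec q p := by
  unfold Prec at *
  rw [Ne, Prod.ext_iff] at hne
  omega

end Prec

/-- Every finite set of symbols can be listed increasingly for `Prec`. -/
lemma exists_prec_enum (s : Finset (ℕ × ℕ)) :
    ∃ v : ℕ → ℕ × ℕ, (∀ i j, 1 ≤ i → i < j → j ≤ s.card → Prec (v i) (v j)) ∧
      (Finset.Icc 1 s.card).image v = s := by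
  generalize hc : s.card = c
  induction c generalizing s with
  | zero => exact ⟨fun _ => 0, by intros; omega, by simpa using (Finset.card_eq_zero.1 hc).symm⟩
  | succ c ih =>
    obtain ⟨p, hp, hmin⟩ := s.exists_min_image (fun q => toLex q)
      (Finset.card_pos.1 (by omega))
    obtain ⟨v, hv, himg⟩ := ih (s.erase p) (by rw [Finset.card_erase_of_mem hp]; omega)
    refine ⟨fun i => if i ≤ c then v i else p, ?_, ?_⟩
    · intro i j hi hij hj
      have hic : i ≤ c := by omega
      by_cases hjc : j ≤ c
      · simpa only [hic, hjc, if_true] using hv i j hi hij hjc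
      · simp only [hic, hjc, if_true, if_false]
        have hmem : v i ∈ s.erase p := by
          rw [← himg]
          exact Finset.mem_image_of_mem _ (Finset.mem_Icc.2 ⟨hi, hic⟩)
        have hle := hmin _ (Finset.mem_of_mem_erase hmem)
        refine Prec.of_not (fun h => ?_) (Finset.ne_of_mem_erase hmem).symm
        rw [Prod.Lex.toLex_le_toLex] at hle
        unfold Prec at h
        omega
    · have hIcc : Finset.Icc 1 (c + 1) = insert (c + 1) (Finset.Icc 1 c) := by
        ext; simp only [Finset.mem_Icc, Finset.mem_insert]; omega
      have hcongr : (Finset.Icc 1 c).image (fun i => if i ≤ c then v i else p) = s.erase p := by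
        rw [← himg]
        exact Finset.image_congr fun i hi => if_pos (by simpa using (Finset.mem_Icc.1 hi).2)
      rw [hIcc, Finset.image_insert, hcongr, if_neg (by omega), Finset.insert_erase hp]

/-- A counting condition: the norms of `P` are distinct and, when the unused norms receive the
smallest color, every `p ∈ P` has below it more unused symbols than there are `q ∈ P` weakly
below `p`. -/
def IsBallot (m n : ℕ) (P : Finset (ℕ × ℕ)) : Prop :=
  Set.InjOn Prod.snd (P : Set (ℕ × ℕ)) ∧
    ∀ p ∈ P, (P.filter (fun q => ¬ Prec p q)).card + 1 ≤
      ((Finset.Icc 1 n \ P.image Prod.snd).filter (fun x => Prec (m - 1, x) p)).card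

lemma card_add_one_le_of_neighbors {S T : Finset ℕ} (hS : S.Nonempty)
    (hsub : ∀ i ∈ S, i - 1 ∈ T ∧ i + 1 ∈ T) : S.card + 1 ≤ T.card := by
  have hnot : S.min' hS - 1 ∉ S.image (· + 1) := by
    intro h
    obtain ⟨j, hj, hje⟩ := Finset.mem_image.1 h
    have := S.min'_le j hj
    omega
  have hcard : (S.image (· + 1)).card = S.card :=
    Finset.card_image_of_injective _ (add_left_injective 1)
  rw [← hcard, ← Finset.card_insert_of_notMem hnot]
  refine Finset.card_le_card fun x hx => ?_
  rcases Finset.mem_insert.1 hx with rfl | hx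
  · exact (hsub _ (S.min'_mem hS)).1
  · obtain ⟨j, hj, rfl⟩ := Finset.mem_image.1 hx
    exact (hsub j hj).2

lemma IsAdmissible.isBallot {m n : ℕ} {P : Finset (ℕ × ℕ)} (h : IsAdmissible m n P) :
    IsBallot m n P := by
  obtain ⟨w, ⟨hw, hinj⟩, rfl⟩ := h
  have hpos : ∀ {i j}, i ∈ Finset.Icc 1 n → j ∈ Finset.Icc 1 n → (w i).2 = (w j).2 → i = j := by
    intro i j hi hj hij
    exact hinj (Finset.mem_Icc.1 hi) (Finset.mem_Icc.1 hj) hij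
  have mem_pin : ∀ p, p ∈ pin n w ↔ ∃ i, (2 ≤ i ∧ i ≤ n - 1) ∧
      (Prec (w (i - 1)) (w i) ∧ Prec (w (i + 1)) (w i)) ∧ w i = p := by
    intro p
    simp only [pin, Finset.mem_image, Finset.mem_filter, Finset.mem_Icc, and_assoc]
  refine ⟨?_, ?_⟩
  · intro p hp q hq hpq
    obtain ⟨i, hi, -, rfl⟩ := (mem_pin p).1 hp
    obtain ⟨j, hj, -, rfl⟩ := (mem_pin q).1 hq
    rw [hpos (i := i) (j := j) (by rw [Finset.mem_Icc]; omega) (by rw [Finset.mem_Icc]; omega) hpq]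
  · intro p hp
    set S := (Finset.Icc 2 (n - 1)).filter (fun i =>
      (Prec (w (i - 1)) (w i) ∧ Prec (w (i + 1)) (w i)) ∧ ¬ Prec p (w i)) with hSdef
    set T := (Finset.Icc 1 n).filter (fun j => w j ∉ pin n w ∧ Prec (w j) p) with hTdef
    have hS : S.Nonempty := by
      obtain ⟨i, hi, hpk, rfl⟩ := (mem_pin p).1 hp
      refine ⟨i, ?_⟩
      rw [hSdef, Finset.mem_filter, Finset.mem_Icc]
      exact ⟨hi, hpk, fun h => h.asymm h⟩
    have hbelow : ∀ {i j}, i ∈ S → Prec (w j) (w i) → Prec (w j) p := by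
      intro i j hi hji
      have hi' := (Finset.mem_filter.1 hi).2.2
      by_cases hip : p = w i
      · rwa [hip]
      · exact hji.trans (Prec.of_not hi' hip)
    have hnotpin : ∀ {j}, j ∈ Finset.Icc 1 n → w j ∈ pin n w →
        Prec (w (j - 1)) (w j) ∧ Prec (w (j + 1)) (w j) := by
      intro j hj h
      obtain ⟨k, hk, hpk, hkj⟩ := (mem_pin _).1 h
      have : k = j := hpos (by rw [Finset.mem_Icc]; omega) hj (by rw [hkj])
      rwa [← this]
    have hST : S.card + 1 ≤ T.card := by
      refine card_add_one_le_of_neighbors hS ?_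
      · intro i hi
        have hi1 := Finset.mem_Icc.1 (Finset.mem_filter.1 hi).1
        have hpk := (Finset.mem_filter.1 hi).2.1
        have h1 : i - 1 ∈ Finset.Icc 1 n := by rw [Finset.mem_Icc]; omega
        have h2 : i + 1 ∈ Finset.Icc 1 n := by rw [Finset.mem_Icc]; omega
        refine ⟨Finset.mem_filter.2 ⟨h1, fun h => ?_, hbelow hi hpk.1⟩,
          Finset.mem_filter.2 ⟨h2, fun h => ?_, hbelow hi hpk.2⟩⟩
        · have h3 := (hnotpin h1 h).2
          rw [show i - 1 + 1 = i by omega] at h3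
          exact h3.asymm hpk.1
        · have h3 := (hnotpin h2 h).1
          rw [show i + 1 - 1 = i by omega] at h3
          exact h3.asymm hpk.2
    have hleft : ((pin n w).filter (fun q => ¬ Prec p q)).card ≤ S.card := by
      refine le_trans (Finset.card_le_card fun q hq => ?_) (Finset.card_image_le (f := w))
      obtain ⟨hq1, hq2⟩ := Finset.mem_filter.1 hq
      obtain ⟨i, hi, hpk, rfl⟩ := (mem_pin q).1 hq1
      exact Finset.mem_image_of_mem _ (Finset.mem_filter.2 ⟨Finset.mem_Icc.2 hi, hpk, hq2⟩)
    have hright : T.card ≤ ((Finset.Icc 1 n \ (pin n w).image Prod.snd).filter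
        (fun x => Prec (m - 1, x) p)).card := by
      refine Finset.card_le_card_of_injOn (fun j => (w j).2) ?_ ?_
      · intro j hj
        obtain ⟨hj1, hj2, hj3⟩ := Finset.mem_filter.1 hj
        refine Finset.mem_filter.2 ⟨Finset.mem_sdiff.2 ⟨(hw j hj1).2, fun h => ?_⟩, ?_⟩
        · obtain ⟨q, hq, hqj⟩ := Finset.mem_image.1 h
          obtain ⟨i, hi, hpk, rfl⟩ := (mem_pin q).1 hq
          have : i = j := hpos (by rw [Finset.mem_Icc]; omega) hj1 hqj
          exact hj2 (this ▸ hq)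
        · have := (hw j hj1).1
          unfold Prec at hj3 ⊢
          dsimp only
          omega
      · intro i hi j hj hij
        exact hpos (Finset.mem_filter.1 hi).1 (Finset.mem_filter.1 hj).1 hij
    omega

lemma card_unused_norms {m n : ℕ} {P : Finset (ℕ × ℕ)}
    (hP : ∀ p ∈ P, p.1 < m ∧ 1 ≤ p.2 ∧ p.2 ≤ n) (hinj : Set.InjOn Prod.snd (P : Set (ℕ × ℕ))) :
    (Finset.Icc 1 n \ P.image Prod.snd).card = n - P.card := by
  rw [Finset.card_sdiff_of_subset, Nat.card_Icc, Finset.card_image_of_injOn hinj]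
  · omega
  · intro x hx
    obtain ⟨p, hp, rfl⟩ := Finset.mem_image.1 hx
    exact Finset.mem_Icc.2 (hP p hp).2

lemma IsBallot.two_mul_card_lt {m n : ℕ} {P : Finset (ℕ × ℕ)} (hn : 1 ≤ n)
    (hP : ∀ p ∈ P, p.1 < m ∧ 1 ≤ p.2 ∧ p.2 ≤ n) (h : IsBallot m n P) : 2 * P.card + 1 ≤ n := by
  rcases P.eq_empty_or_nonempty with rfl | hne
  · simpa using hn
  · obtain ⟨p, hp, hmin⟩ := P.exists_min_image (fun q => toLex q) hne
    have h1 := h.2 p hp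
    have h2 : P.filter (fun q => ¬ Prec p q) = P := by
      refine Finset.filter_true_of_mem fun q hq hpq => ?_
      have hle := hmin q hq
      rw [Prod.Lex.toLex_le_toLex] at hle
      unfold Prec at hpq
      omega
    have h3 := Finset.card_filter_le (Finset.Icc 1 n \ P.image Prod.snd)
      (fun x => Prec (m - 1, x) p)
    rw [card_unused_norms hP h.1] at h3
    rw [h2] at h1
    omega

lemma IsBallot.isAdmissible {m n : ℕ} {P : Finset (ℕ × ℕ)} (hm : 1 ≤ m) (hn : 1 ≤ n)
    (hP : ∀ p ∈ P, p.1 < m ∧ 1 ≤ p.2 ∧ p.2 ≤ n) (h : IsBallot m n P) : IsAdmissible m n P := by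
  have hcard := h.two_mul_card_lt hn hP
  set U := (Finset.Icc 1 n \ P.image Prod.snd).image (fun x => (m - 1, x)) with hU
  have hUcard : U.card = n - P.card := by
    rw [hU, Finset.card_image_of_injective _ (Prod.mk_right_injective _), card_unused_norms hP h.1]
  obtain ⟨v, hv, hvU⟩ := exists_prec_enum U
  obtain ⟨p, hp, hpP⟩ := exists_prec_enum P
  rw [hUcard] at hv hvU
  set d := P.card with hd
  have hpmem : ∀ {k}, 1 ≤ k → k ≤ d → p k ∈ P := fun h1 h2 => by
    have := Finset.mem_image_of_mem p (Finset.mem_Icc.2 ⟨h1, h2⟩)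
    rwa [hpP] at this
  have hvmem : ∀ {k}, 1 ≤ k → k ≤ n - d → (v k).1 = m - 1 ∧ (v k).2 ∈ Finset.Icc 1 n :=
    fun h1 h2 => by
      have := Finset.mem_image_of_mem v (Finset.mem_Icc.2 ⟨h1, h2⟩)
      rw [hvU, hU] at this
      obtain ⟨x, hx, hxe⟩ := Finset.mem_image.1 this
      rw [← hxe]
      exact ⟨rfl, (Finset.mem_sdiff.1 hx).1⟩
  have hvp : ∀ {k}, 1 ≤ k → k ≤ d → Prec (v (k + 1)) (p k) := by
    intro k hk1 hk2
    by_contra hcon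
    have hb := h.2 (p k) (hpmem hk1 hk2)
    have hlow : k ≤ (P.filter (fun q => ¬ Prec (p k) q)).card := by
      have hinj : Set.InjOn p (Finset.Icc 1 k : Finset ℕ) := by
        intro i hi j hj hij
        rw [Finset.mem_coe, Finset.mem_Icc] at hi hj
        rcases lt_trichotomy i j with hlt | heq | hgt
        · have := hp i j hi.1 hlt (by omega)
          rw [hij] at this
          exact absurd this this.asymm
        · exact heq
        · have := hp j i hj.1 hgt (by omega)
          rw [hij] at this
          exact absurd this this.asymm
      have hc := Finset.card_image_of_injOn hinj
      rw [Nat.card_Icc] at hc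
      have : (Finset.Icc 1 k).image p ⊆ P.filter (fun q => ¬ Prec (p k) q) := by
        intro q hq
        obtain ⟨i, hi, rfl⟩ := Finset.mem_image.1 hq
        rw [Finset.mem_Icc] at hi
        refine Finset.mem_filter.2 ⟨hpmem hi.1 (by omega), fun hki => ?_⟩
        rcases hi.2.lt_or_eq with hlt | heq
        · exact hki.asymm (hp i k hi.1 hlt hk2)
        · exact hki.asymm (heq ▸ hki)
      have := Finset.card_le_card this
      omega
    have hup : ((Finset.Icc 1 n \ P.image Prod.snd).filter
        (fun x => Prec (m - 1, x) (p k))).card ≤ k := by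
      have hsub : ((Finset.Icc 1 n \ P.image Prod.snd).filter
          (fun x => Prec (m - 1, x) (p k))) ⊆ (Finset.Icc 1 k).image (fun i => (v i).2) := by
        intro x hx
        obtain ⟨hx1, hx2⟩ := Finset.mem_filter.1 hx
        have hxU : (m - 1, x) ∈ U := Finset.mem_image_of_mem _ hx1
        rw [← hvU] at hxU
        obtain ⟨i, hi, hix⟩ := Finset.mem_image.1 hxU
        rw [Finset.mem_Icc] at hi
        refine Finset.mem_image.2 ⟨i, Finset.mem_Icc.2 ⟨hi.1, ?_⟩, by rw [hix]⟩
        by_contra hik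
        rw [← hix] at hx2
        rcases (show k + 1 ≤ i by omega).lt_or_eq with hlt | heq
        · exact hcon ((hv (k + 1) i (by omega) hlt hi.2).trans hx2)
        · exact hcon (heq ▸ hx2)
      have := (Finset.card_le_card hsub).trans Finset.card_image_le
      rw [Nat.card_Icc] at this
      omega
    omega
  set w : ℕ → ℕ × ℕ := fun i =>
    if i ≤ 2 * d then (if i % 2 = 1 then v ((i + 1) / 2) else p (i / 2)) else v (i - d) with hw
  have w_odd : ∀ {k}, 1 ≤ k → k ≤ d → w (2 * k - 1) = v k := by
    intro k h1 h2
    rw [hw]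
    dsimp only
    rw [if_pos (by omega), if_pos (by omega), show (2 * k - 1 + 1) / 2 = k by omega]
  have w_even : ∀ {k}, k ≤ d → w (2 * k) = p k := by
    intro k h2
    rw [hw]
    dsimp only
    rw [if_pos (by omega), if_neg (by omega), show 2 * k / 2 = k by omega]
  have w_tail : ∀ {k}, d < k → w (k + d) = v k := by
    intro k h2
    rw [hw]
    dsimp only
    rw [if_neg (by omega), show k + d - d = k by omega]
  have cases_pos : ∀ {i}, 1 ≤ i → i ≤ n → (∃ k, 1 ≤ k ∧ k ≤ d ∧ i = 2 * k - 1) ∨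
      (∃ k, 1 ≤ k ∧ k ≤ d ∧ i = 2 * k) ∨ (∃ k, d < k ∧ k ≤ n - d ∧ i = k + d) := by
    intro i h1 h2
    by_cases hi : i ≤ 2 * d
    · rcases Nat.mod_two_eq_zero_or_one i with h0 | h0
      · exact Or.inr (Or.inl ⟨i / 2, by omega, by omega, by omega⟩)
      · exact Or.inl ⟨(i + 1) / 2, by omega, by omega, by omega⟩
    · exact Or.inr (Or.inr ⟨i - d, by omega, by omega, by omega⟩)
  have hmem : ∀ i ∈ Finset.Icc 1 n, (w i).1 < m ∧ (w i).2 ∈ Finset.Icc 1 n := by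
    intro i hi
    rw [Finset.mem_Icc] at hi
    rcases cases_pos hi.1 hi.2 with ⟨k, h1, h2, rfl⟩ | ⟨k, h1, h2, rfl⟩ | ⟨k, h1, h2, rfl⟩
    · rw [w_odd h1 h2]
      obtain ⟨h3, h4⟩ := hvmem h1 (by omega : k ≤ n - d)
      exact ⟨by omega, h4⟩
    · rw [w_even h2]
      have := hP _ (hpmem h1 h2)
      exact ⟨this.1, Finset.mem_Icc.2 this.2⟩
    · rw [w_tail h1]
      obtain ⟨h3, h4⟩ := hvmem (by omega : 1 ≤ k) h2
      exact ⟨by omega, h4⟩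
  refine ⟨w, ⟨hmem, ?_⟩, ?_⟩
  · have himg : (Finset.Icc 1 n).image (fun i => (w i).2) = Finset.Icc 1 n := by
      refine Finset.Subset.antisymm (Finset.image_subset_iff.2 fun i hi => (hmem i hi).2) ?_
      intro x hx
      rw [Finset.mem_image]
      by_cases hxP : x ∈ P.image Prod.snd
      · obtain ⟨q, hq, rfl⟩ := Finset.mem_image.1 hxP
        rw [← hpP] at hq
        obtain ⟨k, hk, rfl⟩ := Finset.mem_image.1 hq
        rw [Finset.mem_Icc] at hk
        exact ⟨2 * k, by rw [Finset.mem_Icc]; omega, by rw [w_even hk.2]⟩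
      · have hxU : (m - 1, x) ∈ U :=
          Finset.mem_image_of_mem _ (Finset.mem_sdiff.2 ⟨hx, hxP⟩)
        rw [← hvU] at hxU
        obtain ⟨k, hk, hkx⟩ := Finset.mem_image.1 hxU
        rw [Finset.mem_Icc] at hk
        by_cases hkd : k ≤ d
        · exact ⟨2 * k - 1, by rw [Finset.mem_Icc]; omega, by rw [w_odd hk.1 hkd, hkx]⟩
        · exact ⟨k + d, by rw [Finset.mem_Icc]; omega, by rw [w_tail (by omega), hkx]⟩
    have := Finset.card_image_iff.1 (congrArg Finset.card himg)
    rwa [Finset.coe_Icc] at this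
  · ext q
    simp only [pin, Finset.mem_image, Finset.mem_filter, Finset.mem_Icc]
    constructor
    · rintro ⟨i, ⟨hi, hpk1, hpk2⟩, rfl⟩
      rcases cases_pos (i := i) (by omega) (by omega) with
        ⟨k, h1, h2, rfl⟩ | ⟨k, h1, h2, rfl⟩ | ⟨k, h1, h2, rfl⟩
      · exfalso
        rw [w_odd h1 h2, show 2 * k - 1 - 1 = 2 * (k - 1) by omega, w_even (by omega)] at hpk1
        have := hvp (k := k - 1) (by omega) (by omega)
        rw [show k - 1 + 1 = k by omega] at this
        exact this.asymm hpk1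
      · rw [w_even h2]
        exact hpmem h1 h2
      · exfalso
        rw [w_tail h1, show k + d + 1 = (k + 1) + d by omega, w_tail (by omega)] at hpk2
        exact hpk2.asymm (hv k (k + 1) (by omega) (by omega) (by omega))
    · intro hq
      rw [← hpP] at hq
      obtain ⟨k, hk, rfl⟩ := Finset.mem_image.1 hq
      rw [Finset.mem_Icc] at hk
      refine ⟨2 * k, ⟨by omega, ?_, ?_⟩, w_even hk.2⟩
      · rw [w_even hk.2, w_odd hk.1 hk.2]
        exact (hv k (k + 1) hk.1 (by omega) (by omega)).trans (hvp hk.1 hk.2)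
      · rw [w_even hk.2]
        rcases hk.2.lt_or_eq with hlt | heq
        · rw [show 2 * k + 1 = 2 * (k + 1) - 1 by omega, w_odd (by omega) (by omega)]
          exact hvp hk.1 hk.2
        · rw [show 2 * k + 1 = (k + 1) + d by omega, w_tail (by omega)]
          exact hvp hk.1 hk.2

lemma isAdmissible_iff_isBallot {m n : ℕ} {P : Finset (ℕ × ℕ)} (hm : 1 ≤ m) (hn : 1 ≤ n)
    (hP : ∀ p ∈ P, p.1 < m ∧ 1 ≤ p.2 ∧ p.2 ≤ n) : IsAdmissible m n P ↔ IsBallot m n P :=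
  ⟨IsAdmissible.isBallot, IsBallot.isAdmissible hm hn hP⟩

lemma rankIn_lt_rankIn {D : Finset ℕ} {x y : ℕ} (hy : y ∈ D) (hxy : x < y) :
    rankIn D x < rankIn D y := by
  refine Finset.card_lt_card ⟨fun z hz => ?_, fun h => ?_⟩
  · rw [Finset.mem_filter] at hz ⊢
    exact ⟨hz.1, by omega⟩
  · have := (Finset.mem_filter.1 (h (Finset.mem_filter.2 ⟨hy, le_rfl⟩))).2
    omega

lemma rankIn_lt_rankIn_iff {D : Finset ℕ} {x y : ℕ} (hx : x ∈ D) (hy : y ∈ D) :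
    rankIn D x < rankIn D y ↔ x < y := by
  refine ⟨fun h => ?_, rankIn_lt_rankIn hy⟩
  rcases lt_trichotomy x y with hlt | rfl | hgt
  · exact hlt
  · omega
  · have := rankIn_lt_rankIn hx hgt
    omega

lemma rankIn_injOn (D : Finset ℕ) : Set.InjOn (rankIn D) (D : Set ℕ) := by
  intro x hx y hy hxy
  have h1 := rankIn_lt_rankIn_iff hx hy
  have h2 := rankIn_lt_rankIn_iff hy hx
  omega

lemma rankIn_mem_Icc {D : Finset ℕ} {x : ℕ} (hx : x ∈ D) : rankIn D x ∈ Finset.Icc 1 D.card :=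
  Finset.mem_Icc.2 ⟨Finset.card_pos.2 ⟨x, Finset.mem_filter.2 ⟨hx, le_rfl⟩⟩,
    Finset.card_filter_le _ _⟩

lemma image_rankIn (D : Finset ℕ) : D.image (rankIn D) = Finset.Icc 1 D.card := by
  refine Finset.eq_of_subset_of_card_le
    (Finset.image_subset_iff.2 fun x hx => rankIn_mem_Icc hx) ?_
  rw [Finset.card_image_of_injOn (rankIn_injOn D), Nat.card_Icc]
  omega

/-- Standardizing a set of norms inside `D` preserves both sides of the counting condition. -/
lemma isBallot_image_rankIn {D : Finset ℕ} {c : ℕ} {T : Finset (ℕ × ℕ)}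
    (hT : ∀ p ∈ T, p.1 = c ∧ p.2 ∈ D) :
    IsBallot 1 D.card (T.image (fun p => ((0 : ℕ), rankIn D p.2))) ↔
      ∀ p ∈ T, (T.filter (fun q => p.2 ≤ q.2)).card + 1 ≤
        ((D \ T.image Prod.snd).filter (fun x => p.2 < x)).card := by
  set f : ℕ × ℕ → ℕ × ℕ := fun p => ((0 : ℕ), rankIn D p.2) with hf
  have hfinj : Set.InjOn f (T : Set (ℕ × ℕ)) := by
    intro p hp q hq hpq
    have := rankIn_injOn D (hT p hp).2 (hT q hq).2 (congrArg Prod.snd hpq)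
    exact Prod.ext ((hT p hp).1.trans (hT q hq).1.symm) this
  have hinj : Set.InjOn Prod.snd ((T.image f : Finset (ℕ × ℕ)) : Set (ℕ × ℕ)) := by
    intro p hp q hq hpq
    obtain ⟨p', -, rfl⟩ := Finset.mem_image.1 (Finset.mem_coe.1 hp)
    obtain ⟨q', -, rfl⟩ := Finset.mem_image.1 (Finset.mem_coe.1 hq)
    exact Prod.ext rfl hpq
  have hsdiff : Finset.Icc 1 D.card \ (T.image f).image Prod.snd =
      (D \ T.image Prod.snd).image (rankIn D) := by
    rw [← image_rankIn, Finset.image_image]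
    have : T.image (Prod.snd ∘ f) = (T.image Prod.snd).image (rankIn D) := by
      rw [Finset.image_image]; rfl
    rw [this]
    refine (Finset.image_sdiff_of_injOn (rankIn_injOn D) ?_).symm
    exact Finset.image_subset_iff.2 fun p hp => (hT p hp).2
  have hleft : ∀ p ∈ T, ((T.image f).filter (fun q => ¬ Prec (f p) q)).card =
      (T.filter (fun q => p.2 ≤ q.2)).card := by
    intro p hp
    rw [Finset.filter_image, Finset.card_image_of_injOn
      (hfinj.mono (Finset.coe_subset.2 (Finset.filter_subset _ _)))]
    congr 1
    refine Finset.filter_congr fun q hq => ?_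
    have := rankIn_lt_rankIn_iff (hT q hq).2 (hT p hp).2
    simp only [Prec, hf, lt_self_iff_false, true_and, false_or]
    omega
  have hright : ∀ p ∈ T, ((Finset.Icc 1 D.card \ (T.image f).image Prod.snd).filter
      (fun x => Prec (1 - 1, x) (f p))).card =
      ((D \ T.image Prod.snd).filter (fun x => p.2 < x)).card := by
    intro p hp
    rw [hsdiff, Finset.filter_image, Finset.card_image_of_injOn
      ((rankIn_injOn D).mono (Finset.coe_subset.2
        ((Finset.filter_subset _ _).trans Finset.sdiff_subset)))]
    congr 1
    refine Finset.filter_congr fun x hx => ?_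
    have := rankIn_lt_rankIn_iff (hT p hp).2 (Finset.mem_sdiff.1 hx).1
    simp only [Prec, hf, Nat.sub_self, lt_self_iff_false, true_and, false_or]
    exact this
  simp only [IsBallot, hinj, true_and, Finset.forall_mem_image]
  exact forall₂_congr fun p hp => by rw [hleft p hp, hright p hp]

lemma injOn_snd_iff_disjoint (P : Finset (ℕ × ℕ)) :
    Set.InjOn Prod.snd (P : Set (ℕ × ℕ)) ↔ ∀ i j : ℕ, i ≠ j →
      Disjoint ((P.filter (fun p => p.1 = i)).image Prod.snd)
        ((P.filter (fun p => p.1 = j)).image Prod.snd) := by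
  constructor
  · intro h i j hij
    rw [Finset.disjoint_left]
    intro x hx hy
    obtain ⟨p, hp, rfl⟩ := Finset.mem_image.1 hx
    obtain ⟨q, hq, hqp⟩ := Finset.mem_image.1 hy
    rw [Finset.mem_filter] at hp hq
    have := h hq.1 hp.1 hqp
    exact hij (by rw [← hp.2, ← hq.2, this])
  · intro h p hp q hq hpq
    by_cases hc : p.1 = q.1
    · exact Prod.ext hc hpq
    · have hp' : p.2 ∈ (P.filter (fun r => r.1 = p.1)).image Prod.snd :=
        Finset.mem_image_of_mem _ (Finset.mem_filter.2 ⟨hp, rfl⟩)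
      have hq' : q.2 ∈ (P.filter (fun r => r.1 = q.1)).image Prod.snd :=
        Finset.mem_image_of_mem _ (Finset.mem_filter.2 ⟨hq, rfl⟩)
      rw [← hpq] at hq'
      exact absurd hq' (Finset.disjoint_left.1 (h _ _ hc) hp')

/-- For `P` small enough, the counting condition only has content at the smallest color. -/
lemma isBallot_iff_smallest_color {m n : ℕ} {P : Finset (ℕ × ℕ)}
    (hP : ∀ p ∈ P, p.1 < m ∧ 1 ≤ p.2 ∧ p.2 ≤ n)
    (hinj : Set.InjOn Prod.snd (P : Set (ℕ × ℕ))) (hcard : 2 * P.card + 1 ≤ n) :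
    IsBallot m n P ↔ ∀ p ∈ P.filter (fun p => p.1 = m - 1),
      ((P.filter (fun p => p.1 = m - 1)).filter (fun q => p.2 ≤ q.2)).card + 1 ≤
        ((Finset.Icc 1 n \ P.image Prod.snd).filter (fun x => p.2 < x)).card := by
  have key : ∀ p ∈ P, p.1 = m - 1 →
      P.filter (fun q => ¬ Prec p q) =
        (P.filter (fun p => p.1 = m - 1)).filter (fun q => p.2 ≤ q.2) ∧
      (Finset.Icc 1 n \ P.image Prod.snd).filter (fun x => Prec (m - 1, x) p) =
        (Finset.Icc 1 n \ P.image Prod.snd).filter (fun x => p.2 < x) := by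
    intro p hp hpm
    constructor
    · rw [Finset.filter_filter]
      refine Finset.filter_congr fun q hq => ?_
      have := (hP q hq).1
      unfold Prec
      omega
    · refine Finset.filter_congr fun x _ => ?_
      unfold Prec
      dsimp only
      omega
  constructor
  · intro h p hp
    obtain ⟨hp, hpm⟩ := Finset.mem_filter.1 hp
    obtain ⟨h1, h2⟩ := key p hp hpm
    rw [← h1, ← h2]
    exact h.2 p hp
  · refine fun h => ⟨hinj, fun p hp => ?_⟩
    by_cases hpm : p.1 = m - 1
    · obtain ⟨h1, h2⟩ := key p hp hpm
      rw [h1, h2]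
      exact h p (Finset.mem_filter.2 ⟨hp, hpm⟩)
    · have hlt := (hP p hp).1
      have hprec : ∀ x ∈ Finset.Icc 1 n \ P.image Prod.snd, Prec (m - 1, x) p :=
        fun x _ => Or.inl (show p.1 < m - 1 by omega)
      rw [Finset.filter_true_of_mem hprec, card_unused_norms hP hinj]
      have := Finset.card_filter_le P (fun q => ¬ Prec p q)
      omega

/-- Characterization of admissibility in terms of the top-color part `π_{m-1}(P)`. -/
theorem admissible_iff_piTop (m n d : ℕ) (hm : 1 ≤ m) (hn : 1 ≤ n)
    (P : Finset (ℕ × ℕ)) (hPsub : ∀ p ∈ P, p.1 < m ∧ 1 ≤ p.2 ∧ p.2 ≤ n)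
    (hd : P.card = d) :
    P ∈ APS m n d ↔
      d ≤ (n - 1) / 2 ∧
      (∀ i j : ℕ, i ≠ j →
        Disjoint ((P.filter (fun p => p.1 = i)).image Prod.snd)
          ((P.filter (fun p => p.1 = j)).image Prod.snd)) ∧
      ((P.filter (fun p => p.1 = m - 1)).image
          (fun p => ((0 : ℕ),
            rankIn (Finset.Icc 1 n \ ((P.filter (fun q => q.1 ≠ m - 1)).image Prod.snd)) p.2)))
        ∈ APS 1 (n - (P.filter (fun q => q.1 ≠ m - 1)).card)
            ((P.filter (fun q => q.1 = m - 1)).card) := by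
  set T := P.filter (fun p => p.1 = m - 1) with hT
  set R := P.filter (fun q => q.1 ≠ m - 1) with hR
  set D := Finset.Icc 1 n \ R.image Prod.snd with hD
  have hmem : P ∈ APS m n d ↔ IsBallot m n P := by
    rw [← isAdmissible_iff_isBallot hm hn hPsub]
    exact and_iff_left hd.le
  rw [hmem, ← injOn_snd_iff_disjoint]
  suffices hmain : Set.InjOn Prod.snd (P : Set (ℕ × ℕ)) → 2 * P.card + 1 ≤ n →
      (IsBallot m n P ↔ T.image (fun p => ((0 : ℕ), rankIn D p.2)) ∈
        APS 1 (n - R.card) T.card) by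
    constructor
    · intro h
      have hcard := h.two_mul_card_lt hn hPsub
      exact ⟨by omega, h.1, (hmain h.1 hcard).1 h⟩
    · rintro ⟨hcard, hinj, h⟩
      exact (hmain hinj (by omega)).2 h
  intro hinj hcard
  have hRP : R ⊆ P := Finset.filter_subset _ _
  have hDcard : D.card = n - R.card :=
    card_unused_norms (fun p hp => hPsub p (hRP hp)) (hinj.mono (Finset.coe_subset.2 hRP))
  have hTD : ∀ p ∈ T, p.1 = m - 1 ∧ p.2 ∈ D := by
    intro p hp
    obtain ⟨hpP, hpm⟩ := Finset.mem_filter.1 hp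
    refine ⟨hpm, Finset.mem_sdiff.2 ⟨Finset.mem_Icc.2 (hPsub p hpP).2, fun h => ?_⟩⟩
    obtain ⟨q, hq, hqp⟩ := Finset.mem_image.1 h
    obtain ⟨hqP, hqm⟩ := Finset.mem_filter.1 hq
    exact hqm (hinj hqP hpP hqp ▸ hpm)
  have hsdiff : D \ T.image Prod.snd = Finset.Icc 1 n \ P.image Prod.snd := by
    rw [hD, sdiff_sdiff_left, Finset.sup_eq_union, ← Finset.image_union, Finset.union_comm,
      Finset.filter_union_filter_not_eq]
  have hRcard := Finset.card_le_card hRP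
  have hadm := isAdmissible_iff_isBallot (m := 1) (n := D.card)
    (P := T.image (fun p => ((0 : ℕ), rankIn D p.2))) le_rfl (by omega) (by
      intro q hq
      obtain ⟨p, hp, rfl⟩ := Finset.mem_image.1 hq
      exact ⟨Nat.one_pos, Finset.mem_Icc.1 (rankIn_mem_Icc (hTD p hp).2)⟩)
  rw [isBallot_iff_smallest_color hPsub hinj hcard, ← hsdiff, ← isBallot_image_rankIn hTD, ← hadm,
    hDcard]
  exact (and_iff_left Finset.card_image_le).symm
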